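/- Vanishing fluctuations of the critic samples around the evolving stationary measure: for any fixed state-action pair ξ = (x,a) and any T > 0, lim_{N→∞} E | (1/N) Σ_{k=0}^{⌊NT⌋−1} [ 1_{{(x_k,a_k) = ξ}} − π^{g_{θ_k}}(ξ) ] | = 0. -/

import Mathlib

open MeasureTheory Filter Set
open scoped Classical

noncomputable section

def softmaxPol {X A : Type*} [Fintype A] (θ : X → A → ℝ) (x : X) (a : A) : ℝ :=
  Real.exp (θ x a) / ∑ a', Real.exp (θ x a')

def explorePol {X A : Type*} [Fintype A] (η : ℝ) (θ : X → A → ℝ) (x : X) (a : A) : ℝ :=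
  η / (Fintype.card A : ℝ) + (1 - η) * softmaxPol θ x a

def zetaN (N k : ℕ) : ℝ := (1 + (k : ℝ) / (N : ℝ))⁻¹

def etaN (N k : ℕ) : ℝ := (1 + (Real.log ((k : ℝ) / (N : ℝ) + 1)) ^ 2)⁻¹

def zetaT (t : ℝ) : ℝ := (1 + t)⁻¹

def etaT (t : ℝ) : ℝ := (1 + (Real.log (t + 1)) ^ 2)⁻¹

def IsPolicy {X A : Type*} [Fintype A] (f : X → A → ℝ) : Prop :=
  (∀ x a, 0 ≤ f x a) ∧ ∀ x, ∑ a, f x a = 1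

def ptilde {X A : Type*} (γ : ℝ) (p : X → A → X → ℝ) (μ : X → ℝ)
    (x : X) (a : A) (x' : X) : ℝ :=
  γ * p x a x' + (1 - γ) * μ x'

def actorKer {X A : Type*} (γ : ℝ) (p : X → A → X → ℝ) (μ : X → ℝ) (f : X → A → ℝ) :
    X × A → X × A → ℝ :=
  fun ξ ξ' => ptilde γ p μ ξ.1 ξ.2 ξ'.1 * f ξ'.1 ξ'.2

def criticKer {X A : Type*} (p : X → A → X → ℝ) (g : X → A → ℝ) :
    X × A → X × A → ℝ :=
  fun ξ ξ' => p ξ.1 ξ.2 ξ'.1 * g ξ'.1 ξ'.2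

def kpow {S : Type*} [Fintype S] [DecidableEq S] (K : S → S → ℝ) : ℕ → S → S → ℝ
  | 0 => fun ξ ξ' => if ξ = ξ' then 1 else 0
  | n + 1 => fun ξ ξ' => ∑ y, K ξ y * kpow K n y ξ'

def IsStationaryDist {S : Type*} [Fintype S] (K : S → S → ℝ) (d : S → ℝ) : Prop :=
  (∀ ξ, 0 ≤ d ξ) ∧ (∑ ξ, d ξ = 1) ∧ ∀ ξ', d ξ' = ∑ ξ, d ξ * K ξ ξ'

def pathSum {X A : Type*} [Fintype X] [Fintype A] [DecidableEq X]
    (p : X → A → X → ℝ) : ℕ → X → A → X → ℝ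
  | 0 => fun x _ x' => if x = x' then 1 else 0
  | 1 => fun x a x' => p x a x'
  | n + 2 => fun x a x' => ∑ x₁ : X, ∑ a₁ : A, p x a x₁ * pathSum p (n + 1) x₁ a₁ x'

section FiniteChains

variable {S : Type*} [Fintype S]

theorem sum_kpow_mul_eq_of_harmonic [DecidableEq S] {K : S → S → ℝ} {v : S → ℝ}
    (hv : ∀ x, ∑ y, K x y * v y = v x) (n : ℕ) (x : S) :
    ∑ y, kpow K n x y * v y = v x := by
  induction n generalizing x with
  | zero => simp [kpow]
  | succ n ih =>
    simp only [kpow, Finset.sum_mul]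
    rw [Finset.sum_comm]
    simp_rw [mul_assoc, ← Finset.mul_sum, ih]
    exact hv x

theorem harmonic_eq_of_kpow_pos [DecidableEq S] [Nonempty S] {K : S → S → ℝ}
    (hK : ∀ x, ∑ y, K x y = 1) {n : ℕ} (hn : ∀ x y, 0 < kpow K n x y) {v : S → ℝ}
    (hv : ∀ x, ∑ y, K x y * v y = v x) : ∃ c, ∀ x, v x = c := by
  obtain ⟨x₀, hx₀⟩ := Finite.exists_max v
  refine ⟨v x₀, fun y => ?_⟩
  have h1 := sum_kpow_mul_eq_of_harmonic (v := fun _ => (1 : ℝ)) (by simpa using hK) n x₀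
  have h2 := sum_kpow_mul_eq_of_harmonic hv n x₀
  have h3 : ∑ y, kpow K n x₀ y * (v x₀ - v y) = 0 := by
    simp only [mul_one] at h1
    simp_rw [mul_sub, Finset.sum_sub_distrib, ← Finset.sum_mul]
    rw [h1, h2]
    ring
  have h4 := (Finset.sum_eq_zero_iff_of_nonneg
    (fun y _ => mul_nonneg (hn x₀ y).le (sub_nonneg.2 (hx₀ y)))).1 h3 y (Finset.mem_univ y)
  have := (mul_eq_zero.1 h4).resolve_left (hn x₀ y).ne'
  linarith

def fundamentalMatrix [DecidableEq S] (K : S → S → ℝ) (d : S → ℝ) : Matrix S S ℝ :=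
  1 - Matrix.of K + Matrix.of fun _ y => d y

theorem fundamentalMatrix_mulVec [DecidableEq S] (K : S → S → ℝ) (d v : S → ℝ) (x : S) :
    (fundamentalMatrix K d).mulVec v x = v x - ∑ y, K x y * v y + ∑ y, d y * v y := by
  simp [fundamentalMatrix, Matrix.mulVec, dotProduct, sub_mul, add_mul, Finset.sum_add_distrib,
    Matrix.one_apply]

theorem IsStationaryDist.sum_mul_sum {K : S → S → ℝ} {d : S → ℝ} (hd : IsStationaryDist K d)
    (v : S → ℝ) : ∑ x, d x * ∑ y, K x y * v y = ∑ y, d y * v y := by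
  simp_rw [Finset.mul_sum]
  rw [Finset.sum_comm]
  refine Finset.sum_congr rfl fun y _ => ?_
  rw [hd.2.2 y, Finset.sum_mul]
  exact Finset.sum_congr rfl fun x _ => by ring

theorem IsStationaryDist.sum_mul_fundamentalMatrix_mulVec [DecidableEq S] {K : S → S → ℝ}
    {d : S → ℝ} (hd : IsStationaryDist K d) (v : S → ℝ) :
    ∑ x, d x * (fundamentalMatrix K d).mulVec v x = ∑ y, d y * v y := by
  simp_rw [fundamentalMatrix_mulVec, mul_add, mul_sub, Finset.sum_add_distrib,
    Finset.sum_sub_distrib]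
  rw [hd.sum_mul_sum, ← Finset.sum_mul, hd.2.1]
  ring

theorem IsStationaryDist.det_fundamentalMatrix_ne_zero [DecidableEq S] [Nonempty S]
    {K : S → S → ℝ} {d : S → ℝ} (hd : IsStationaryDist K d) (hK : ∀ x, ∑ y, K x y = 1) {n : ℕ}
    (hn : ∀ x y, 0 < kpow K n x y) : (fundamentalMatrix K d).det ≠ 0 := by
  intro h
  obtain ⟨v, hv0, hv⟩ := Matrix.exists_mulVec_eq_zero_iff.2 h
  have hdv : ∑ y, d y * v y = 0 := by
    rw [← hd.sum_mul_fundamentalMatrix_mulVec v, hv]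
    simp
  have hharm : ∀ x, ∑ y, K x y * v y = v x := by
    intro x
    have := congrFun hv x
    rw [fundamentalMatrix_mulVec, hdv] at this
    simp only [Pi.zero_apply] at this
    linarith
  obtain ⟨c, hc⟩ := harmonic_eq_of_kpow_pos hK hn hharm
  apply hv0
  funext x
  simp only [hc, ← Finset.sum_mul, hd.2.1] at hdv
  simpa [hc] using hdv

theorem IsStationaryDist.poisson_equation [DecidableEq S] {K : S → S → ℝ} {d : S → ℝ}
    (hd : IsStationaryDist K d) (hdet : (fundamentalMatrix K d).det ≠ 0) (φ : S → ℝ) (x : S) :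
    (fundamentalMatrix K d)⁻¹.mulVec φ x -
        ∑ y, K x y * (fundamentalMatrix K d)⁻¹.mulVec φ y = φ x - ∑ y, d y * φ y := by
  set h := (fundamentalMatrix K d)⁻¹.mulVec φ with hh
  have hMh : (fundamentalMatrix K d).mulVec h = φ := by
    rw [hh, Matrix.mulVec_mulVec, Matrix.mul_nonsing_inv _ (isUnit_iff_ne_zero.2 hdet),
      Matrix.one_mulVec]
  have h1 := hd.sum_mul_fundamentalMatrix_mulVec h
  have h2 := fundamentalMatrix_mulVec K d h x
  rw [hMh] at h1 h2
  linarith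

end FiniteChains

section Policies

variable {X A : Type*} [Fintype A]

theorem sum_exp_pos [Nonempty A] (θ : X → A → ℝ) (x : X) : 0 < ∑ a, Real.exp (θ x a) :=
  Finset.sum_pos (fun _ _ => Real.exp_pos _) Finset.univ_nonempty

theorem isPolicy_softmaxPol [Nonempty A] (θ : X → A → ℝ) : IsPolicy (softmaxPol θ) := by
  refine ⟨fun x a => div_nonneg (Real.exp_pos _).le (sum_exp_pos θ x).le, fun x => ?_⟩
  simp only [softmaxPol]
  rw [← Finset.sum_div, div_self (sum_exp_pos θ x).ne']

theorem isPolicy_explorePol [Nonempty A] {η : ℝ} (h0 : 0 ≤ η) (h1 : η ≤ 1) (θ : X → A → ℝ) :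
    IsPolicy (explorePol η θ) := by
  refine ⟨fun x a => add_nonneg (by positivity)
    (mul_nonneg (by linarith) ((isPolicy_softmaxPol θ).1 x a)), fun x => ?_⟩
  simp only [explorePol]
  rw [Finset.sum_add_distrib, ← Finset.mul_sum, (isPolicy_softmaxPol θ).2 x]
  have : (Fintype.card A : ℝ) ≠ 0 := by simp
  simp
  field_simp
  ring

theorem IsPolicy.le_one {f : X → A → ℝ} (hf : IsPolicy f) (x : X) (a : A) : f x a ≤ 1 := by
  rw [← hf.2 x]
  exact Finset.single_le_sum (fun a _ => hf.1 x a) (Finset.mem_univ a)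

theorem explorePol_one (θ : X → A → ℝ) : explorePol 1 θ = explorePol 0 (0 : X → A → ℝ) := by
  funext x a
  simp [explorePol, softmaxPol]

theorem continuous_softmaxPol [Nonempty A] (x : X) (a : A) :
    Continuous fun θ : X → A → ℝ => softmaxPol θ x a := by
  unfold softmaxPol
  exact Continuous.div (by fun_prop) (by fun_prop) fun θ => (sum_exp_pos θ x).ne'

theorem sum_criticKer [Fintype X] {p : X → A → X → ℝ} (hp1 : ∀ x a, ∑ x', p x a x' = 1)
    {g : X → A → ℝ} (hg : IsPolicy g) (ξ : X × A) : ∑ ξ', criticKer p g ξ ξ' = 1 := by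
  simp only [criticKer, Fintype.sum_prod_type]
  simp_rw [← Finset.mul_sum, hg.2, mul_one]
  exact hp1 _ _

theorem etaT_pos (t : ℝ) : 0 < etaT t := by
  unfold etaT; positivity

theorem etaT_le_one (t : ℝ) : etaT t ≤ 1 := by
  unfold etaT
  exact inv_le_one_of_one_le₀ (by nlinarith [sq_nonneg (Real.log (t + 1))])

theorem continuousOn_etaT : ContinuousOn etaT (Ici 0) := by
  unfold etaT
  refine ContinuousOn.inv₀ ?_ fun t _ => by positivity
  refine continuousOn_const.add (ContinuousOn.pow (ContinuousOn.log (by fun_prop) ?_) 2)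
  intro t ht
  have : (0 : ℝ) ≤ t := ht
  positivity

theorem continuousOn_explorePol_etaT [Nonempty A] (x : X) (a : A) :
    ContinuousOn (fun z : ℝ × (X → A → ℝ) => explorePol (etaT z.1) z.2 x a)
      (Ici 0 ×ˢ univ) := by
  have h1 : ContinuousOn (fun z : ℝ × (X → A → ℝ) => etaT z.1) (Ici 0 ×ˢ univ) :=
    continuousOn_etaT.comp continuousOn_fst fun z hz => hz.1
  have h2 : ContinuousOn (fun z : ℝ × (X → A → ℝ) => softmaxPol z.2 x a) (Ici 0 ×ˢ univ) :=
    ((continuous_softmaxPol x a).comp continuous_snd).continuousOn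
  exact (h1.div_const _).add ((continuousOn_const.sub h1).mul h2)

theorem continuous_of_sum_abs_sub_le [Fintype X] {S : Type*} [Fintype S]
    {Φ : (X → A → ℝ) → S → ℝ}
    (hΦ : ∃ L : ℝ, ∀ f f', ∑ s, |Φ f s - Φ f' s| ≤ L * ∑ x, ∑ a, |f x a - f' x a|) :
    Continuous Φ := by
  obtain ⟨L, hL⟩ := hΦ
  refine continuous_pi fun s => continuous_iff_continuousAt.2 fun f => ?_
  rw [ContinuousAt, tendsto_iff_dist_tendsto_zero]
  have hc : Tendsto (fun f' : X → A → ℝ => L * ∑ x, ∑ a, |f' x a - f x a|) (nhds f) (nhds 0) := by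
    have : Continuous fun f' : X → A → ℝ => L * ∑ x, ∑ a, |f' x a - f x a| := by fun_prop
    simpa using this.tendsto f
  refine squeeze_zero (fun _ => dist_nonneg) (fun f' => ?_) hc
  rw [Real.dist_eq]
  exact (Finset.single_le_sum (f := fun s => |Φ f' s - Φ f s|) (fun _ _ => abs_nonneg _)
    (Finset.mem_univ s)).trans (hL f' f)

theorem exists_continuousOn_poisson_solution [Fintype X] [Nonempty X] [Nonempty A]
    [DecidableEq X] [DecidableEq A] {p : X → A → X → ℝ}
    (hp1 : ∀ x a, ∑ x', p x a x' = 1) {pista : (X → A → ℝ) → X × A → ℝ}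
    (hpi : ∀ (η : ℝ) (θ : X → A → ℝ), 0 ≤ η → η < 1 →
      IsStationaryDist (criticKer p (explorePol η θ)) (pista (explorePol η θ)))
    (hpiLip : ∃ L : ℝ, ∀ f f' : X → A → ℝ,
      ∑ ξ : X × A, |pista f ξ - pista f' ξ| ≤ L * ∑ x, ∑ a, |f x a - f' x a|)
    (hergC : ∀ (η : ℝ) (θ : X → A → ℝ), 0 ≤ η → η < 1 → ∃ n, 0 < n ∧
      ∀ ξ ξ' : X × A, 0 < kpow (criticKer p (explorePol η θ)) n ξ ξ') (φ : X × A → ℝ) :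
    ∃ H : ℝ × (X → A → ℝ) → X × A → ℝ, ContinuousOn H (Ici 0 ×ˢ univ) ∧
      ∀ t θ ξ, H (t, θ) ξ - ∑ ξ', criticKer p (explorePol (etaT t) θ) ξ ξ' * H (t, θ) ξ'
        = φ ξ - ∑ ξ', pista (explorePol (etaT t) θ) ξ' * φ ξ' := by
  have key : ∀ t θ, IsStationaryDist (criticKer p (explorePol (etaT t) θ))
        (pista (explorePol (etaT t) θ)) ∧
      (fundamentalMatrix (criticKer p (explorePol (etaT t) θ))
        (pista (explorePol (etaT t) θ))).det ≠ 0 := by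
    intro t θ
    have hsum := sum_criticKer hp1 (isPolicy_explorePol (etaT_pos t).le (etaT_le_one t) θ)
    rcases (etaT_le_one t).lt_or_eq with h | h
    · obtain ⟨n, -, hn⟩ := hergC _ θ (etaT_pos t).le h
      have hst := hpi _ θ (etaT_pos t).le h
      exact ⟨hst, hst.det_fundamentalMatrix_ne_zero hsum hn⟩
    · rw [h, explorePol_one] at hsum ⊢
      obtain ⟨n, -, hn⟩ := hergC 0 0 le_rfl zero_lt_one
      have hst := hpi 0 0 le_rfl zero_lt_one
      exact ⟨hst, hst.det_fundamentalMatrix_ne_zero hsum hn⟩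
  refine ⟨fun z => (fundamentalMatrix (criticKer p (explorePol (etaT z.1) z.2))
    (pista (explorePol (etaT z.1) z.2)))⁻¹.mulVec φ, ?_, fun t θ ξ =>
      (key t θ).1.poisson_equation (key t θ).2 φ ξ⟩
  have hg : ContinuousOn (fun z : ℝ × (X → A → ℝ) => explorePol (etaT z.1) z.2)
      (Ici 0 ×ˢ univ) :=
    continuousOn_pi.2 fun x => continuousOn_pi.2 fun a => continuousOn_explorePol_etaT x a
  have hM : Continuous fun g : X → A → ℝ => fundamentalMatrix (criticKer p g) (pista g) := by
    have hpc := continuous_of_sum_abs_sub_le hpiLip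
    refine continuous_matrix fun ξ ξ' => ?_
    simp only [fundamentalMatrix, criticKer, Matrix.add_apply, Matrix.sub_apply, Matrix.of_apply]
    fun_prop
  intro z hz
  have hMz := hM.comp_continuousOn hg z hz
  have hinv : ContinuousWithinAt (fun z : ℝ × (X → A → ℝ) =>
      (fundamentalMatrix (criticKer p (explorePol (etaT z.1) z.2))
        (pista (explorePol (etaT z.1) z.2)))⁻¹) (Ici 0 ×ˢ univ) z := by
    refine ContinuousAt.comp_continuousWithinAt (g := fun M : Matrix (X × A) (X × A) ℝ => M⁻¹)
      (continuousAt_matrix_inv _ ?_) hMz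
    rw [Ring.inverse_eq_inv']
    exact continuousAt_inv₀ (key z.1 z.2).2
  exact ContinuousAt.comp_continuousWithinAt (g := fun M : Matrix (X × A) (X × A) ℝ => M.mulVec φ)
    (Continuous.matrix_mulVec continuous_id continuous_const).continuousAt hinv

end Policies

section MartingaleDifferences

variable {Ω : Type*} [mΩ : MeasurableSpace Ω] {P : Measure Ω} [IsProbabilityMeasure P]

theorem integral_sq_sum_le_of_condExp_eq_zero (ℱ : MeasureTheory.Filtration ℕ mΩ)
    {D : ℕ → Ω → ℝ} {C : ℝ} (n : ℕ) (hD : ∀ k < n, Measurable[ℱ (k + 1)] (D k))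
    (hC : ∀ k < n, ∀ ω, |D k ω| ≤ C) (h0 : ∀ k < n, P[D k|ℱ k] =ᵐ[P] 0) :
    ∫ ω, (∑ k ∈ Finset.range n, D k ω) ^ 2 ∂P ≤ n * C ^ 2 := by
  induction n with
  | zero => simp
  | succ n ih =>
    specialize ih (fun k hk => hD k (by omega)) (fun k hk => hC k (by omega))
      (fun k hk => h0 k (by omega))
    set S : Ω → ℝ := fun ω => ∑ k ∈ Finset.range n, D k ω with hS
    have hSm : Measurable[ℱ n] S := by
      refine Finset.measurable_fun_sum _ fun k hk => ?_
      have hk := Finset.mem_range.1 hk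
      exact (hD k (by omega)).mono (ℱ.mono hk) le_rfl
    have hSm' : Measurable S := hSm.mono (ℱ.le n) le_rfl
    have hDm : Measurable (D n) := (hD n (by omega)).mono (ℱ.le _) le_rfl
    have hDb : ∀ ω, |D n ω| ≤ C := hC n (by omega)
    have hSb : ∀ ω, |S ω| ≤ n * C := fun ω => by
      refine (Finset.abs_sum_le_sum_abs _ _).trans ((Finset.sum_le_card_nsmul _ _ C
        fun k hk => hC k (by have := Finset.mem_range.1 hk; omega) ω).trans (by simp))
    have hDi : Integrable (D n) P :=
      .of_bound hDm.aestronglyMeasurable C (.of_forall hDb)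
    have hSDi : Integrable (S * D n) P := by
      refine .of_bound (hSm'.mul hDm).aestronglyMeasurable (n * C * C) (.of_forall fun ω => ?_)
      rw [Pi.mul_apply, norm_mul]
      exact mul_le_mul (hSb ω) (hDb ω) (abs_nonneg _) ((abs_nonneg _).trans (hSb ω))
    have hSSi : Integrable (fun ω => S ω ^ 2) P := by
      refine .of_bound (hSm'.pow_const 2).aestronglyMeasurable ((n * C) ^ 2)
        (.of_forall fun ω => ?_)
      rw [norm_pow]
      exact pow_le_pow_left₀ (norm_nonneg _) (hSb ω) 2
    have hDDi : Integrable (fun ω => D n ω ^ 2) P := by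
      refine .of_bound (hDm.pow_const 2).aestronglyMeasurable (C ^ 2) (.of_forall fun ω => ?_)
      rw [norm_pow]
      exact pow_le_pow_left₀ (norm_nonneg _) (hDb ω) 2
    have hcross : ∫ ω, S ω * D n ω ∂P = 0 := by
      have h1 : P[S * D n|ℱ n] =ᵐ[P] 0 := by
        filter_upwards [condExp_mul_of_stronglyMeasurable_left hSm.stronglyMeasurable hSDi hDi,
          h0 n (by omega)] with ω h2 h3
        rw [h2, Pi.mul_apply, h3]
        simp
      have h4 := integral_condExp (μ := P) (f := S * D n) (ℱ.le n)
      rw [integral_congr_ae h1] at h4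
      simpa using h4.symm
    have hDD : ∫ ω, D n ω ^ 2 ∂P ≤ C ^ 2 := by
      calc ∫ ω, D n ω ^ 2 ∂P ≤ ∫ _, C ^ 2 ∂P :=
            integral_mono hDDi (integrable_const _) fun ω => sq_le_sq.2
              ((hDb ω).trans (le_abs_self C))
        _ = C ^ 2 := by simp
    have hexp : ∀ ω, (∑ k ∈ Finset.range (n + 1), D k ω) ^ 2
        = S ω ^ 2 + 2 * (S ω * D n ω) + D n ω ^ 2 := fun ω => by
      rw [Finset.sum_range_succ]
      ring
    simp_rw [hexp]
    have hSDi' : Integrable (fun ω => 2 * (S ω * D n ω)) P := hSDi.const_mul 2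
    have hadd : Integrable (fun ω => S ω ^ 2 + 2 * (S ω * D n ω)) P := hSSi.add hSDi'
    rw [integral_add hadd hDDi, integral_add hSSi hSDi', integral_const_mul, hcross]
    push_cast
    linarith

theorem integral_abs_sum_le_of_condExp_eq_zero (ℱ : MeasureTheory.Filtration ℕ mΩ)
    {D : ℕ → Ω → ℝ} {C : ℝ} (n : ℕ) (hD : ∀ k < n, Measurable[ℱ (k + 1)] (D k))
    (hC : ∀ k < n, ∀ ω, |D k ω| ≤ C) (h0 : ∀ k < n, P[D k|ℱ k] =ᵐ[P] 0) :
    Integrable (fun ω => ∑ k ∈ Finset.range n, D k ω) P ∧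
      ∫ ω, |∑ k ∈ Finset.range n, D k ω| ∂P ≤ (C ^ 2 + 1) * √n := by
  set S : Ω → ℝ := fun ω => ∑ k ∈ Finset.range n, D k ω with hS
  have hSm : Measurable S := Finset.measurable_fun_sum _ fun k hk =>
    (hD k (Finset.mem_range.1 hk)).mono (ℱ.le _) le_rfl
  have hSb : ∀ ω, |S ω| ≤ n * C := fun ω =>
    (Finset.abs_sum_le_sum_abs _ _).trans ((Finset.sum_le_card_nsmul _ _ C
      fun k hk => hC k (Finset.mem_range.1 hk) ω).trans (by simp))
  have hSi : Integrable S P := .of_bound hSm.aestronglyMeasurable _ (.of_forall hSb)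
  refine ⟨hSi, ?_⟩
  rcases Nat.eq_zero_or_pos n with rfl | hn
  · simp
  have hSSi : Integrable (fun ω => S ω ^ 2) P := by
    refine .of_bound (hSm.pow_const 2).aestronglyMeasurable ((n * C) ^ 2)
      (.of_forall fun ω => ?_)
    rw [norm_pow]
    exact pow_le_pow_left₀ (norm_nonneg _) (hSb ω) 2
  have hs : 0 < √(n : ℝ) := Real.sqrt_pos.2 (by exact_mod_cast hn)
  have hss : √(n : ℝ) * √n = n := Real.mul_self_sqrt (Nat.cast_nonneg n)
  calc ∫ ω, |S ω| ∂P ≤ ∫ ω, ((√n)⁻¹ * S ω ^ 2 + √n) ∂P := by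
        refine integral_mono hSi.abs ((hSSi.const_mul _).add (integrable_const _)) fun ω => ?_
        have : |S ω| * √n ≤ S ω ^ 2 + √n * √n := by
          nlinarith [sq_nonneg (|S ω| - √n), sq_abs (S ω), sq_nonneg (|S ω|), sq_nonneg (√(n : ℝ))]
        have h2 : (√(n : ℝ))⁻¹ * S ω ^ 2 + √n = (S ω ^ 2 + √n * √n) / √n := by
          field_simp
        show |S ω| ≤ (√(n : ℝ))⁻¹ * S ω ^ 2 + √n
        rw [h2, le_div_iff₀ hs]
        exact this
    _ = (√n)⁻¹ * ∫ ω, S ω ^ 2 ∂P + √n := by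
        rw [integral_add (hSSi.const_mul _) (integrable_const _), integral_const_mul]
        simp
    _ ≤ (√n)⁻¹ * (n * C ^ 2) + √n := by
        gcongr
        exact integral_sq_sum_le_of_condExp_eq_zero ℱ n hD hC h0
    _ = (√n)⁻¹ * ((√n * √n) * C ^ 2) + √n := by rw [hss]
    _ = (C ^ 2 + 1) * √n := by field_simp

theorem condExp_apply_sub_sum_eq_zero {S : Type*} [Fintype S] [DecidableEq S] [MeasurableSpace S]
    [MeasurableSingletonClass S] {Z : Ω → S} (hZ : Measurable Z) {m : MeasurableSpace Ω}
    (hm : m ≤ mΩ) {q h : Ω → S → ℝ} (hq : Measurable[m] q) (hh : Measurable[m] h) {B : ℝ}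
    (hB : ∀ ω s, |h ω s| ≤ B)
    (hcond : ∀ s, P[(fun ω => if Z ω = s then (1 : ℝ) else 0)|m] =ᵐ[P] fun ω => q ω s) :
    P[(fun ω => h ω (Z ω) - ∑ s, q ω s * h ω s)|m] =ᵐ[P] 0 := by
  have hhs : ∀ s, Measurable[m] fun ω => h ω s := fun s => (measurable_pi_apply s).comp hh
  have hqs : ∀ s, Measurable[m] fun ω => q ω s := fun s => (measurable_pi_apply s).comp hq
  have hI : ∀ s, Integrable (fun ω => if Z ω = s then (1 : ℝ) else 0) P := fun s => by
    refine .of_bound (Measurable.ite (hZ (measurableSet_singleton s)) measurable_const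
      measurable_const).aestronglyMeasurable 1 (.of_forall fun ω => ?_)
    split_ifs <;> simp
  have hqi : ∀ s, Integrable (fun ω => q ω s) P := fun s => integrable_condExp.congr (hcond s)
  have heq : (fun ω => h ω (Z ω) - ∑ s, q ω s * h ω s)
      = ∑ s, (fun ω => h ω s) * ((fun ω => if Z ω = s then (1 : ℝ) else 0) - fun ω => q ω s) := by
    funext ω
    simp [mul_sub, mul_comm]
  have hbm : ∀ s, Integrable ((fun ω => h ω s) *
      ((fun ω => if Z ω = s then (1 : ℝ) else 0) - fun ω => q ω s)) P := fun s =>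
    ((hI s).sub (hqi s)).bdd_mul ((hhs s).mono hm le_rfl).aestronglyMeasurable
      (.of_forall fun ω => hB ω s)
  rw [heq]
  refine (condExp_finsetSum (fun s _ => hbm s) m).trans ?_
  have hz : ∀ s, P[(fun ω => h ω s) * ((fun ω => if Z ω = s then (1 : ℝ) else 0) -
      fun ω => q ω s)|m] =ᵐ[P] 0 := fun s => by
    have hqe : P[(fun ω => q ω s)|m] = fun ω => q ω s :=
      condExp_of_stronglyMeasurable hm (hqs s).stronglyMeasurable (hqi s)
    filter_upwards [condExp_mul_of_stronglyMeasurable_left (hhs s).stronglyMeasurable (hbm s)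
      ((hI s).sub (hqi s)), condExp_sub (hI s) (hqi s) m, hcond s] with ω h1 h2 h3
    rw [h1, Pi.mul_apply, h2, Pi.sub_apply, h3, hqe]
    simp
  filter_upwards [ae_all_iff.2 hz] with ω hω
  simp [Finset.sum_apply, hω]

end MartingaleDifferences

theorem measurable_apply_of_countable {Ω D E : Type*} {_ : MeasurableSpace Ω} [MeasurableSpace D]
    [Countable D] [MeasurableSingletonClass D] [MeasurableSpace E] {f : Ω → D} {U : D → Ω → E}
    (hf : Measurable f) (hU : ∀ d, Measurable (U d)) : Measurable fun ω => U (f ω) ω :=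
  (measurable_from_prod_countable_left (f := fun z : Ω × D => U z.2 z.1) hU).comp
    (measurable_id.prodMk hf)

theorem integral_abs_sum_sub_le_of_drift {S Ω : Type*} [Fintype S] [DecidableEq S]
    [MeasurableSpace S] [MeasurableSingletonClass S] [mΩ : MeasurableSpace Ω] {P : Measure Ω}
    [IsProbabilityMeasure P] (ℱ : MeasureTheory.Filtration ℕ mΩ) {Z : ℕ → Ω → S}
    (hZ : ∀ k, Measurable[ℱ k] (Z k)) {q h w : ℕ → Ω → S → ℝ} {n : ℕ} {B ε : ℝ}
    (hq : ∀ k < n, Measurable[ℱ k] (q k)) (hh : ∀ k < n, Measurable[ℱ k] (h (k + 1)))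
    (hcond : ∀ k < n, ∀ s,
      P[(fun ω => if Z (k + 1) ω = s then (1 : ℝ) else 0)|ℱ k] =ᵐ[P] fun ω => q k ω s)
    (hw : ∀ k < n, ∀ ω, w (k + 1) ω (Z k ω) = ∑ s, q k ω s * h (k + 1) ω s)
    (hhB : ∀ k ≤ n, ∀ ω s, |h k ω s| ≤ B) (hwB : ∀ k ≤ n, ∀ ω s, |w k ω s| ≤ B)
    (hwε : ∀ k < n, ∀ ω s, |w (k + 1) ω s - w k ω s| ≤ ε) :
    ∫ ω, |∑ k ∈ Finset.range n, (h k ω (Z k ω) - w k ω (Z k ω))| ∂P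
      ≤ 2 * B + ((2 * B) ^ 2 + 1) * √n + n * ε := by
  set D : ℕ → Ω → ℝ := fun k ω => h (k + 1) ω (Z (k + 1) ω) - w (k + 1) ω (Z k ω) with hD
  have hD' : ∀ k < n, D k = fun ω => h (k + 1) ω (Z (k + 1) ω) - ∑ s, q k ω s * h (k + 1) ω s :=
    fun k hk => funext fun ω => by simp only [hD, hw k hk]
  have hDm : ∀ k < n, Measurable[ℱ (k + 1)] (D k) := by
    intro k hk
    rw [hD' k hk]
    have h1 : Measurable[ℱ (k + 1)] (h (k + 1)) := (hh k hk).mono (ℱ.mono k.le_succ) le_rfl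
    have h2 : Measurable[ℱ (k + 1)] (q k) := (hq k hk).mono (ℱ.mono k.le_succ) le_rfl
    have h1s : ∀ s, Measurable[ℱ (k + 1)] fun ω => h (k + 1) ω s :=
      fun s => (measurable_pi_apply s).comp h1
    refine Measurable.sub (measurable_apply_of_countable (U := fun s ω => h (k + 1) ω s)
      (hZ (k + 1)) h1s) ?_
    exact Finset.measurable_fun_sum _ fun s _ =>
      ((measurable_pi_apply s).comp h2).mul (h1s s)
  have hDB : ∀ k < n, ∀ ω, |D k ω| ≤ 2 * B := fun k hk ω => by
    have h1 := hhB (k + 1) hk ω (Z (k + 1) ω)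
    have h2 := hwB (k + 1) hk ω (Z k ω)
    have := abs_sub (h (k + 1) ω (Z (k + 1) ω)) (w (k + 1) ω (Z k ω))
    simp only [hD]
    linarith
  have hD0 : ∀ k < n, P[D k|ℱ k] =ᵐ[P] 0 := fun k hk => by
    rw [hD' k hk]
    exact condExp_apply_sub_sum_eq_zero ((hZ (k + 1)).mono (ℱ.le _) le_rfl) (ℱ.le k) (hq k hk)
      (hh k hk) (hhB (k + 1) hk) (hcond k hk)
  obtain ⟨hi, hM⟩ := integral_abs_sum_le_of_condExp_eq_zero ℱ n hDm hDB hD0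
  have hpt : ∀ ω, |∑ k ∈ Finset.range n, (h k ω (Z k ω) - w k ω (Z k ω))|
      ≤ |∑ k ∈ Finset.range n, D k ω| + (2 * B + n * ε) := by
    intro ω
    have hsplit : ∑ k ∈ Finset.range n, (h k ω (Z k ω) - w k ω (Z k ω))
        = ∑ k ∈ Finset.range n, D k ω + ((h 0 ω (Z 0 ω) - h n ω (Z n ω))
          + ∑ k ∈ Finset.range n, (w (k + 1) ω (Z k ω) - w k ω (Z k ω))) := by
      rw [← Finset.sum_range_sub' (fun k => h k ω (Z k ω)) n, ← Finset.sum_add_distrib,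
        ← Finset.sum_add_distrib]
      refine Finset.sum_congr rfl fun k _ => ?_
      simp only [hD]
      ring
    have h1 : |∑ k ∈ Finset.range n, (w (k + 1) ω (Z k ω) - w k ω (Z k ω))| ≤ n * ε :=
      (Finset.abs_sum_le_sum_abs _ _).trans ((Finset.sum_le_card_nsmul _ _ ε
        fun k hk => hwε k (Finset.mem_range.1 hk) ω _).trans (by simp))
    have h2 := abs_sub (h 0 ω (Z 0 ω)) (h n ω (Z n ω))
    have h3 := hhB 0 (Nat.zero_le n) ω (Z 0 ω)
    have h4 := hhB n le_rfl ω (Z n ω)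
    rw [hsplit]
    refine (abs_add_le _ _).trans (add_le_add le_rfl ((abs_add_le _ _).trans ?_))
    linarith
  calc _ ≤ ∫ ω, (|∑ k ∈ Finset.range n, D k ω| + (2 * B + n * ε)) ∂P :=
        integral_mono_of_nonneg (.of_forall fun _ => abs_nonneg _)
          (hi.abs.add (integrable_const _)) (.of_forall hpt)
    _ = ∫ ω, |∑ k ∈ Finset.range n, D k ω| ∂P + (2 * B + n * ε) := by
        rw [integral_add hi.abs (integrable_const _)]
        simp
    _ ≤ _ := by linarith

theorem measurable_explorePol {X A Ω : Type*} [Finite X] [Fintype A] [Nonempty A]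
    {_ : MeasurableSpace Ω} (η : ℝ) {θ : Ω → X → A → ℝ}
    (hθ : Measurable θ) (y : X) (b : A) : Measurable fun ω => explorePol η (θ ω) y b :=
  (((continuous_softmaxPol y b).measurable.comp hθ).const_mul _).const_add _

section Iterates

variable {X A : Type*} [Fintype A] [DecidableEq X] [DecidableEq A]

theorem abs_critic_iterate_le {r : X → A → ℝ} {γ β C : ℝ}
    (hr : ∀ x a, 0 ≤ r x a ∧ r x a ≤ 1) (hγ0 : 0 ≤ γ) (hγ1 : γ ≤ 1) (hβ : 0 ≤ β)
    {x : ℕ → X} {a : ℕ → A} {Q g : ℕ → X → A → ℝ} (hg : ∀ k, IsPolicy (g k)) (hC : 1 ≤ C)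
    (h0 : ∀ y b, |Q 0 y b| ≤ C)
    (hrec : ∀ k y b, Q (k + 1) y b = Q k y b + β *
      (r (x k) (a k) + γ * (∑ b', Q k (x (k + 1)) b' * g k (x (k + 1)) b') - Q k (x k) (a k)) *
      (if x k = y ∧ a k = b then 1 else 0)) (k : ℕ) (y : X) (b : A) :
    |Q k y b| ≤ C * (1 + 3 * β) ^ k := by
  induction k generalizing y b with
  | zero => simpa using h0 y b
  | succ k ih =>
    set c := C * (1 + 3 * β) ^ k with hc
    have hc1 : 1 ≤ c := one_le_mul_of_one_le_of_one_le hC (one_le_pow₀ (by linarith))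
    have hs : |∑ b', Q k (x (k + 1)) b' * g k (x (k + 1)) b'| ≤ c := by
      calc _ ≤ ∑ b', |Q k (x (k + 1)) b' * g k (x (k + 1)) b'| := Finset.abs_sum_le_sum_abs _ _
        _ ≤ ∑ b', c * g k (x (k + 1)) b' := Finset.sum_le_sum fun b' _ => by
            rw [abs_mul, abs_of_nonneg ((hg k).1 _ _)]
            exact mul_le_mul_of_nonneg_right (ih _ _) ((hg k).1 _ _)
        _ = c := by rw [← Finset.mul_sum, (hg k).2, mul_one]
    have hγs : |γ * ∑ b', Q k (x (k + 1)) b' * g k (x (k + 1)) b'| ≤ c := by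
      rw [abs_mul, abs_of_nonneg hγ0]
      nlinarith [abs_nonneg (∑ b', Q k (x (k + 1)) b' * g k (x (k + 1)) b')]
    have hδ : |r (x k) (a k) + γ * (∑ b', Q k (x (k + 1)) b' * g k (x (k + 1)) b')
        - Q k (x k) (a k)| ≤ 3 * c := by
      have h1 := hr (x k) (a k)
      have h2 := ih (x k) (a k)
      rw [abs_le] at hγs h2 ⊢
      constructor <;> linarith [h1.1, h1.2, hγs.1, hγs.2, h2.1, h2.2]
    have hite : |(if x k = y ∧ a k = b then (1 : ℝ) else 0)| ≤ 1 := by split_ifs <;> simp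
    rw [hrec, pow_succ, ← mul_assoc, ← hc]
    refine (abs_add_le _ _).trans ?_
    rw [abs_mul, abs_mul, abs_of_nonneg hβ]
    have h3 : β * |r (x k) (a k) + γ * (∑ b', Q k (x (k + 1)) b' * g k (x (k + 1)) b')
        - Q k (x k) (a k)| * |(if x k = y ∧ a k = b then (1 : ℝ) else 0)| ≤ β * (3 * c) * 1 := by
      gcongr
    linarith [ih y b]

variable [Fintype X]

theorem norm_actor_step_le [Nonempty A] {c B : ℝ} (hc : 0 ≤ c) (hB : 0 ≤ B)
    {Q θ θ' : X → A → ℝ} {x : X} {a : A} (hQ : ∀ y b, |Q y b| ≤ B)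
    (hrec : ∀ y b, θ' y b = θ y b + c * Q x a * (if x = y then 1 else 0) *
      ((if a = b then 1 else 0) - softmaxPol θ x b)) : ‖θ' - θ‖ ≤ c * B := by
  refine (pi_norm_le_iff_of_nonneg (by positivity)).2 fun y =>
    (pi_norm_le_iff_of_nonneg (by positivity)).2 fun b => ?_
  rw [Pi.sub_apply, Pi.sub_apply, hrec, add_sub_cancel_left, Real.norm_eq_abs, abs_mul, abs_mul,
    abs_mul, abs_of_nonneg hc]
  have h1 : |(if x = y then (1 : ℝ) else 0)| ≤ 1 := by split_ifs <;> simp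
  have h2 : |(if a = b then (1 : ℝ) else 0) - softmaxPol θ x b| ≤ 1 := by
    have h3 := (isPolicy_softmaxPol θ).1 x b
    have h4 := (isPolicy_softmaxPol θ).le_one x b
    rw [abs_le]
    split_ifs <;> constructor <;> linarith
  calc _ ≤ c * B * 1 * 1 := by
        gcongr
        exact hQ x a
    _ = c * B := by ring

variable {Ω : Type*} [MeasurableSpace X] [MeasurableSingletonClass X] [MeasurableSpace A]
  [MeasurableSingletonClass A]

theorem measurable_actor_step [Nonempty A] {_ : MeasurableSpace Ω} {c : ℝ} {Q θ θ' : Ω → X → A → ℝ}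
    {x : Ω → X} {a : Ω → A} (hQ : Measurable Q) (hθ : Measurable θ)
    (hxa : Measurable fun ω => (x ω, a ω))
    (hrec : ∀ ω y b, θ' ω y b = θ ω y b + c * Q ω (x ω) (a ω) * (if x ω = y then 1 else 0) *
      ((if a ω = b then 1 else 0) - softmaxPol (θ ω) (x ω) b)) : Measurable θ' := by
  refine measurable_pi_iff.2 fun y => measurable_pi_iff.2 fun b => ?_
  simp_rw [hrec]
  refine measurable_apply_of_countable (f := fun ω => (x ω, a ω))
    (U := fun d ω => θ ω y b + c * Q ω d.1 d.2 * (if d.1 = y then 1 else 0) *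
      ((if d.2 = b then 1 else 0) - softmaxPol (θ ω) d.1 b)) hxa fun d => ?_
  have h1 : Measurable fun ω => softmaxPol (θ ω) d.1 b :=
    (continuous_softmaxPol d.1 b).measurable.comp hθ
  have h2 : Measurable fun ω => Q ω d.1 d.2 := by fun_prop
  have h3 : Measurable fun ω => θ ω y b := by fun_prop
  exact h3.add (((h2.const_mul c).mul_const _).mul (measurable_const.sub h1))

theorem measurable_critic_step [Nonempty A] {_ : MeasurableSpace Ω} {r : X → A → ℝ} {γ β η : ℝ}
    {Q θ Q' : Ω → X → A → ℝ} {x x' : Ω → X} {a : Ω → A} (hQ : Measurable Q) (hθ : Measurable θ)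
    (hxa : Measurable fun ω => (x ω, a ω)) (hx' : Measurable x')
    (hrec : ∀ ω y b, Q' ω y b = Q ω y b + β *
      (r (x ω) (a ω) + γ * (∑ b', Q ω (x' ω) b' * explorePol η (θ ω) (x' ω) b')
        - Q ω (x ω) (a ω)) * (if x ω = y ∧ a ω = b then 1 else 0)) : Measurable Q' := by
  refine measurable_pi_iff.2 fun y => measurable_pi_iff.2 fun b => ?_
  simp_rw [hrec]
  refine measurable_apply_of_countable (f := fun ω => ((x ω, a ω), x' ω))
    (U := fun d ω => Q ω y b + β *
      (r d.1.1 d.1.2 + γ * (∑ b', Q ω d.2 b' * explorePol η (θ ω) d.2 b')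
        - Q ω d.1.1 d.1.2) * (if d.1.1 = y ∧ d.1.2 = b then 1 else 0)) (hxa.prodMk hx') fun d => ?_
  have h1 : ∀ b', Measurable fun ω => explorePol η (θ ω) d.2 b' := measurable_explorePol η hθ d.2
  fun_prop

end Iterates

theorem critic_sample_fluctuations_vanish
    {X A : Type*} [Fintype X] [Fintype A] [Nonempty X] [Nonempty A]
    [DecidableEq X] [DecidableEq A]
    (p : X → A → X → ℝ) (μ : X → ℝ) (r : X → A → ℝ) (γ α : ℝ)
    (hp0 : ∀ x a x', 0 ≤ p x a x') (hp1 : ∀ x a, ∑ x', p x a x' = 1)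
    (hμ0 : ∀ x, 0 ≤ μ x) (hμ1 : ∑ x, μ x = 1)
    (hr : ∀ x a, 0 ≤ r x a ∧ r x a ≤ 1) (hγ : 0 < γ ∧ γ < 1) (hα : 0 < α)
    (sigsta : (X → A → ℝ) → X × A → ℝ)
    (hsig : ∀ θ : X → A → ℝ,
      IsStationaryDist (actorKer γ p μ (softmaxPol θ)) (sigsta (softmaxPol θ)))
    (hsigLip : ∃ L : ℝ, ∀ f f' : X → A → ℝ,
      ∑ ξ : X × A, |sigsta f ξ - sigsta f' ξ| ≤ L * ∑ x, ∑ a, |f x a - f' x a|)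
    (hergA : ∀ θ : X → A → ℝ, ∃ n, 0 < n ∧
      ∀ ξ ξ' : X × A, 0 < kpow (actorKer γ p μ (softmaxPol θ)) n ξ ξ')
    (pista : (X → A → ℝ) → X × A → ℝ)
    (hpi : ∀ (η : ℝ) (θ : X → A → ℝ), 0 ≤ η → η < 1 →
      IsStationaryDist (criticKer p (explorePol η θ)) (pista (explorePol η θ)))
    (hpiLip : ∃ L : ℝ, ∀ f f' : X → A → ℝ,
      ∑ ξ : X × A, |pista f ξ - pista f' ξ| ≤ L * ∑ x, ∑ a, |f x a - f' x a|)
    (hergC : ∀ (η : ℝ) (θ : X → A → ℝ), 0 ≤ η → η < 1 → ∃ n, 0 < n ∧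
      ∀ ξ ξ' : X × A, 0 < kpow (criticKer p (explorePol η θ)) n ξ ξ')
    {Ω : Type*} [mΩ : MeasurableSpace Ω] (P : Measure Ω) [IsProbabilityMeasure P]
    [MeasurableSpace X] [MeasurableSingletonClass X]
    [MeasurableSpace A] [MeasurableSingletonClass A]
    (Q0 θ0 : X → A → ℝ)
    (F : ℕ → MeasureTheory.Filtration ℕ mΩ)
    (xc : ℕ → ℕ → Ω → X) (ac : ℕ → ℕ → Ω → A)
    (xa : ℕ → ℕ → Ω → X) (aa : ℕ → ℕ → Ω → A)
    (Q θ : ℕ → ℕ → Ω → X → A → ℝ)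
    (hQinit : ∀ N ω, Q N 0 ω = Q0) (hθinit : ∀ N ω, θ N 0 ω = θ0)
    (hQrec : ∀ N k ω x a, Q N (k + 1) ω x a = Q N k ω x a + (α / N) *
      (r (xc N k ω) (ac N k ω) + γ * (∑ a'', Q N k ω (xc N (k + 1) ω) a'' *
          explorePol (etaN N k) (θ N k ω) (xc N (k + 1) ω) a'')
        - Q N k ω (xc N k ω) (ac N k ω)) *
      (if xc N k ω = x ∧ ac N k ω = a then 1 else 0))
    (hθrec : ∀ N k ω x a, θ N (k + 1) ω x a = θ N k ω x a + (zetaN N k / N) *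
      Q N k ω (xa N k ω) (aa N k ω) * (if xa N k ω = x then 1 else 0) *
      ((if aa N k ω = a then 1 else 0) - softmaxPol (θ N k ω) (xa N k ω) a))
    (hadaptc : ∀ N k, Measurable[(F N) k] fun ω => (xc N k ω, ac N k ω))
    (hadapta : ∀ N k, Measurable[(F N) k] fun ω => (xa N k ω, aa N k ω))
    (hMarkovC : ∀ N k (ξ' : X × A),
      (P[(fun ω => if (xc N (k + 1) ω, ac N (k + 1) ω) = ξ' then (1 : ℝ) else 0)|(F N) k])
        =ᵐ[P] fun ω => p (xc N k ω) (ac N k ω) ξ'.1 *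
          explorePol (etaN N (k + 1)) (θ N (k + 1) ω) ξ'.1 ξ'.2)
    (hMarkovA : ∀ N k (ξ' : X × A),
      (P[(fun ω => if (xa N (k + 1) ω, aa N (k + 1) ω) = ξ' then (1 : ℝ) else 0)|(F N) k])
        =ᵐ[P] fun ω => ptilde γ p μ (xa N k ω) (aa N k ω) ξ'.1 *
          softmaxPol (θ N (k + 1) ω) ξ'.1 ξ'.2)
    (ξ : X × A) (T : ℝ) (hT : 0 < T) :
    Tendsto (fun N : ℕ => ∫ ω, |(1 / (N : ℝ)) * ∑ k ∈ Finset.range ⌊(N : ℝ) * T⌋₊,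
        ((if (xc N k ω, ac N k ω) = ξ then (1 : ℝ) else 0) -
          pista (explorePol (etaN N k) (θ N k ω)) ξ)| ∂P)
      atTop (nhds 0) := by
  obtain ⟨H, hHc, hHeq⟩ := exists_continuousOn_poisson_solution hp1 hpi hpiLip hergC
    (fun ξ' => if ξ' = ξ then (1 : ℝ) else 0)
  set W : ℝ × (X → A → ℝ) → X × A → ℝ := fun z ξ₁ =>
    ∑ ξ', criticKer p (explorePol (etaT z.1) z.2) ξ₁ ξ' * H z ξ' with hW
  have hWc : ContinuousOn W (Ici 0 ×ˢ univ) := by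
    refine continuousOn_pi.2 fun ξ₁ => continuousOn_finsetSum _ fun ξ' _ => ?_
    exact (continuousOn_const.mul (continuousOn_explorePol_etaT ξ'.1 ξ'.2)).mul
      (continuousOn_pi.1 hHc ξ')
  set C : ℝ := 1 + ‖Q0‖ with hCdef
  set BQ : ℝ := C * Real.exp (3 * α * T) with hBQ
  have hC1 : 1 ≤ C := by simp [hCdef]
  have hBQ0 : 0 ≤ BQ := by positivity
  have hQ0 : ∀ y b, |Q0 y b| ≤ C := fun y b => by
    have h1 : ‖Q0 y b‖ ≤ ‖Q0‖ := (norm_le_pi_norm (Q0 y) b).trans (norm_le_pi_norm Q0 y)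
    rw [Real.norm_eq_abs] at h1
    linarith
  have hη0 : ∀ N k, 0 ≤ etaN N k := fun N k => (etaT_pos ((k : ℝ) / N)).le
  have hη1 : ∀ N k, etaN N k ≤ 1 := fun N k => etaT_le_one ((k : ℝ) / N)
  have hQB : ∀ N : ℕ, 0 < N → ∀ k : ℕ, (k : ℝ) ≤ N * T → ∀ ω y b, |Q N k ω y b| ≤ BQ := by
    intro N hN k hk ω y b
    have hN' : (0 : ℝ) < N := by exact_mod_cast hN
    have h1 := abs_critic_iterate_le (β := α / N) (x := fun k => xc N k ω) (a := fun k => ac N k ω)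
      (Q := fun k => Q N k ω) (g := fun k => explorePol (etaN N k) (θ N k ω)) hr hγ.1.le hγ.2.le
      (by positivity) (fun k => isPolicy_explorePol (hη0 N k) (hη1 N k) _) hC1
      (by simpa [hQinit] using hQ0) (fun k y b => hQrec N k ω y b) k y b
    refine h1.trans (mul_le_mul_of_nonneg_left ?_ (by positivity))
    calc (1 + 3 * (α / N)) ^ k ≤ Real.exp (3 * (α / N)) ^ k := by
          gcongr
          linarith [Real.add_one_le_exp (3 * (α / N))]
      _ = Real.exp (k * (3 * (α / N))) := (Real.exp_nat_mul _ _).symm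
      _ ≤ Real.exp (3 * α * T) := by
          refine Real.exp_le_exp.2 ?_
          calc k * (3 * (α / N)) ≤ (N * T) * (3 * (α / N)) := by gcongr
            _ = 3 * α * T := by field_simp
  have hθstep : ∀ N : ℕ, 0 < N → ∀ k : ℕ, (k : ℝ) ≤ N * T → ∀ ω,
      ‖θ N (k + 1) ω - θ N k ω‖ ≤ BQ / N := by
    intro N hN k hk ω
    have hζ0 : 0 ≤ zetaN N k := by unfold zetaN; positivity
    have hζ1 : zetaN N k ≤ 1 := by
      unfold zetaN
      exact inv_le_one_of_one_le₀ (le_add_of_nonneg_right (by positivity))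
    have h1 := norm_actor_step_le (c := zetaN N k / N) (by positivity) hBQ0 (hQB N hN k hk ω)
      (fun y b => hθrec N k ω y b)
    refine h1.trans ?_
    calc zetaN N k / N * BQ ≤ 1 / N * BQ := by gcongr
      _ = BQ / N := by ring
  have hθB : ∀ N : ℕ, 0 < N → ∀ k : ℕ, (k : ℝ) ≤ N * T → ∀ ω, ‖θ N k ω‖ ≤ ‖θ0‖ + BQ * T := by
    intro N hN k hk ω
    have hN' : (0 : ℝ) < N := by exact_mod_cast hN
    have h1 : ‖θ N k ω‖ ≤ ‖θ0‖ + k * (BQ / N) := by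
      induction k with
      | zero => simp [hθinit]
      | succ k ih =>
        push_cast at hk ⊢
        have h2 := ih (by linarith)
        have h3 := hθstep N hN k (by linarith) ω
        have h4 := norm_le_norm_add_norm_sub' (θ N (k + 1) ω) (θ N k ω)
        linarith
    refine h1.trans ?_
    have : (k : ℝ) * (BQ / N) ≤ (N * T) * (BQ / N) := by gcongr
    have h5 : (N * T) * (BQ / N) = BQ * T := by field_simp
    linarith
  set K : Set (ℝ × (X → A → ℝ)) := Icc 0 T ×ˢ Metric.closedBall 0 (‖θ0‖ + BQ * T) with hK
  have hKc : IsCompact K := isCompact_Icc.prod (isCompact_closedBall _ _)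
  have hKsub : K ⊆ Ici 0 ×ˢ univ := fun z hz => ⟨hz.1.1, mem_univ _⟩
  have hmem : ∀ N : ℕ, 0 < N → ∀ k : ℕ, (k : ℝ) ≤ N * T → ∀ ω, ((k : ℝ) / N, θ N k ω) ∈ K := by
    intro N hN k hk ω
    have hN' : (0 : ℝ) < N := by exact_mod_cast hN
    refine ⟨⟨by positivity, ?_⟩, by simpa using hθB N hN k hk ω⟩
    rw [div_le_iff₀ hN']
    linarith
  obtain ⟨BH, hBH⟩ := hKc.exists_bound_of_continuousOn (hHc.mono hKsub)
  obtain ⟨BW, hBW⟩ := hKc.exists_bound_of_continuousOn (hWc.mono hKsub)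
  have hWu := hKc.uniformContinuousOn_of_continuous (hWc.mono hKsub)
  set B := max BH BW with hB
  have hmeas : ∀ N k, Measurable[F N k] (Q N k) ∧ Measurable[F N k] (θ N k) := by
    intro N k
    induction k with
    | zero =>
      have h1 : Q N 0 = fun _ => Q0 := funext (hQinit N)
      have h2 : θ N 0 = fun _ => θ0 := funext (hθinit N)
      rw [h1, h2]
      exact ⟨measurable_const, measurable_const⟩
    | succ k ih =>
      have hle := (F N).mono k.le_succ
      refine ⟨?_, (measurable_actor_step ih.1 ih.2 (hadapta N k) (hθrec N k)).mono hle le_rfl⟩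
      exact measurable_critic_step (ih.1.mono hle le_rfl) (ih.2.mono hle le_rfl)
        ((hadaptc N k).mono hle le_rfl) (hadaptc N (k + 1)).fst (hQrec N k)
  have hθm : ∀ N k, Measurable[F N k] (θ N (k + 1)) := fun N k =>
    measurable_actor_step (hmeas N k).1 (hmeas N k).2 (hadapta N k) (hθrec N k)
  have hbound : ∀ N : ℕ, 0 < N → ∀ ε, (∀ k < ⌊(N : ℝ) * T⌋₊, ∀ ω ξ₁,
      |W (((k + 1 : ℕ) : ℝ) / N, θ N (k + 1) ω) ξ₁ - W ((k : ℝ) / N, θ N k ω) ξ₁| ≤ ε) →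
      ∫ ω, |∑ k ∈ Finset.range ⌊(N : ℝ) * T⌋₊, ((if (xc N k ω, ac N k ω) = ξ then (1 : ℝ) else 0) -
          pista (explorePol (etaN N k) (θ N k ω)) ξ)| ∂P
        ≤ 2 * B + ((2 * B) ^ 2 + 1) * √(⌊(N : ℝ) * T⌋₊ : ℝ) + ⌊(N : ℝ) * T⌋₊ * ε := by
    intro N hN ε hε
    have hN' : (0 : ℝ) < N := by exact_mod_cast hN
    have hle : ∀ k ≤ ⌊(N : ℝ) * T⌋₊, (k : ℝ) ≤ N * T := fun k hk =>
      (Nat.le_floor_iff (by positivity)).1 hk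
    have key := integral_abs_sum_sub_le_of_drift (P := P) (F N)
      (Z := fun k ω => (xc N k ω, ac N k ω)) (hadaptc N)
      (q := fun k ω ξ' => criticKer p (explorePol (etaN N (k + 1)) (θ N (k + 1) ω))
        (xc N k ω, ac N k ω) ξ')
      (h := fun k ω => H ((k : ℝ) / N, θ N k ω)) (w := fun k ω => W ((k : ℝ) / N, θ N k ω))
      (n := ⌊(N : ℝ) * T⌋₊) (B := B) (ε := ε) ?_ ?_ ?_ ?_ ?_ ?_ hε
    · refine le_trans (le_of_eq ?_) key
      refine integral_congr_ae (.of_forall fun ω => ?_)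
      refine congrArg abs (Finset.sum_congr rfl fun k _ => ?_)
      have h1 := hHeq ((k : ℝ) / N) (θ N k ω) (xc N k ω, ac N k ω)
      simp only [mul_ite, mul_one, mul_zero, Finset.sum_ite_eq', Finset.mem_univ, if_true] at h1
      exact h1.symm
    · intro k _
      refine (@measurable_pi_iff _ _ _ (F N k) _ _).2 fun ξ' => ?_
      refine measurable_apply_of_countable (hadaptc N k)
        (U := fun d ω => criticKer p (explorePol (etaN N (k + 1)) (θ N (k + 1) ω)) d ξ')
        fun d => ?_
      exact (measurable_explorePol _ (hθm N k) ξ'.1 ξ'.2).const_mul _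
    · intro k _
      have hc : Continuous fun ϑ : X → A → ℝ => H (((k + 1 : ℕ) : ℝ) / N, ϑ) :=
        hHc.comp_continuous (by fun_prop) fun ϑ => ⟨by simp only [mem_Ici]; positivity, mem_univ _⟩
      exact hc.measurable.comp (hθm N k)
    · intro k _ ξ'
      exact hMarkovC N k ξ'
    · intro k _ ω
      rfl
    · intro k hk ω ξ₁
      exact (norm_le_pi_norm _ ξ₁).trans
        ((hBH _ (hmem N hN k (hle k hk) ω)).trans (le_max_left _ _))
    · intro k hk ω ξ₁
      exact (norm_le_pi_norm _ ξ₁).trans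
        ((hBW _ (hmem N hN k (hle k hk) ω)).trans (le_max_right _ _))
  rw [Metric.tendsto_atTop']
  intro ε hε
  obtain ⟨δ, hδ, hδW⟩ := Metric.uniformContinuousOn_iff.1 hWu (ε / (2 * T)) (by positivity)
  have hlim : Tendsto (fun N : ℕ => 2 * B * (N : ℝ)⁻¹ + ((2 * B) ^ 2 + 1) * √T * √((N : ℝ)⁻¹))
      atTop (nhds 0) := by
    have h1 : Tendsto (fun N : ℕ => (N : ℝ)⁻¹) atTop (nhds 0) := tendsto_inv_atTop_nhds_zero_nat
    have h2 := (Real.continuous_sqrt.tendsto 0).comp h1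
    rw [Real.sqrt_zero] at h2
    simpa using (h1.const_mul (2 * B)).add (h2.const_mul (((2 * B) ^ 2 + 1) * √T))
  have hlimδ : Tendsto (fun N : ℕ => (1 + BQ) * (N : ℝ)⁻¹) atTop (nhds 0) := by
    simpa using (tendsto_inv_atTop_nhds_zero_nat (𝕜 := ℝ)).const_mul (1 + BQ)
  obtain ⟨N₀, hN₀⟩ := eventually_atTop.1
    ((hlim.eventually_lt_const (half_pos hε)).and (hlimδ.eventually_lt_const hδ))
  refine ⟨N₀, fun N hN => ?_⟩
  obtain ⟨hN1, hN2⟩ := hN₀ N hN.le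
  have hNpos : 0 < N := by omega
  have hN' : (0 : ℝ) < N := by exact_mod_cast hNpos
  have hfl : (⌊(N : ℝ) * T⌋₊ : ℝ) ≤ N * T := Nat.floor_le (by positivity)
  have hmain := hbound N hNpos (ε / (2 * T)) fun k hk ω ξ₁ => by
    have hk1 : ((k + 1 : ℕ) : ℝ) ≤ N * T := (Nat.le_floor_iff (by positivity)).1 hk
    have hk0 : (k : ℝ) ≤ N * T := by push_cast at hk1; linarith
    have hd : dist (((k + 1 : ℕ) : ℝ) / N, θ N (k + 1) ω) ((k : ℝ) / N, θ N k ω) < δ := by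
      refine lt_of_le_of_lt ?_ hN2
      rw [Prod.dist_eq, max_le_iff]
      constructor
      · have h1 : ((k + 1 : ℕ) : ℝ) / N - (k : ℝ) / N = (N : ℝ)⁻¹ := by
          push_cast
          ring
        rw [Real.dist_eq, h1, abs_of_pos (by positivity)]
        exact le_mul_of_one_le_left (by positivity) (by linarith)
      · rw [dist_eq_norm]
        refine (hθstep N hNpos k hk0 ω).trans ?_
        rw [div_eq_mul_inv]
        gcongr
        linarith
    have h2 := hδW _ (hmem N hNpos (k + 1) hk1 ω) _ (hmem N hNpos k hk0 ω) hd
    rw [← Real.dist_eq]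
    exact (dist_le_pi_dist _ _ ξ₁).trans h2.le
  rw [Real.dist_eq, sub_zero, abs_of_nonneg (integral_nonneg fun _ => abs_nonneg _)]
  simp_rw [abs_mul, abs_of_pos (one_div_pos.2 hN')]
  rw [integral_const_mul]
  have hsq : √(⌊(N : ℝ) * T⌋₊ : ℝ) ≤ N * (√T * √((N : ℝ)⁻¹)) := by
    calc √(⌊(N : ℝ) * T⌋₊ : ℝ) ≤ √(N * T) := Real.sqrt_le_sqrt hfl
      _ = N * (√T * √((N : ℝ)⁻¹)) := by
          rw [Real.sqrt_mul hN'.le, Real.sqrt_inv]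
          have h3 : √(N : ℝ) ≠ 0 := (Real.sqrt_pos.2 hN').ne'
          field_simp
          rw [Real.sq_sqrt hN'.le]
  have hT2 : (⌊(N : ℝ) * T⌋₊ : ℝ) * (ε / (2 * T)) ≤ N * (ε / 2) := by
    calc (⌊(N : ℝ) * T⌋₊ : ℝ) * (ε / (2 * T)) ≤ (N * T) * (ε / (2 * T)) := by gcongr
      _ = N * (ε / 2) := by field_simp
  rw [one_div, inv_mul_lt_iff₀ hN']
  have h4 : ((2 * B) ^ 2 + 1) * √(⌊(N : ℝ) * T⌋₊ : ℝ)
      ≤ ((2 * B) ^ 2 + 1) * (N * (√T * √((N : ℝ)⁻¹))) := by gcongr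
  have h5 : N * (2 * B * (N : ℝ)⁻¹ + ((2 * B) ^ 2 + 1) * √T * √((N : ℝ)⁻¹)) < N * (ε / 2) := by
    gcongr
  have h6 : N * (2 * B * (N : ℝ)⁻¹ + ((2 * B) ^ 2 + 1) * √T * √((N : ℝ)⁻¹))
      = 2 * B + ((2 * B) ^ 2 + 1) * (N * (√T * √((N : ℝ)⁻¹))) := by
    field_simp
  linarith
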